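/- Let n ≥ 1 and let q_1, …, q_r be positive integers with q_1 + ⋯ + q_r = n. Let ν be an n×n complex matrix which is diagonalizable with exactly r distinct eigenvalues whose multiplicities are q_1, …, q_r. Let (X, H, Y) be an sl₂-triple of n×n complex matrices such that for every integer k with 0 ≤ k ≤ n, the ℂ-dimension of the kernel of X^k equals the sum of the k largest values among q_1, …, q_r (counted with repetition). Then the set {g ν g⁻¹ : g ∈ GL(n,ℂ)} ∩ {X + C : C an n×n complex matrix with CY = YC} contains exactly one element. -/

import Mathlib

namespace SliceProof
open Matrix

/-! ### Abstract sl2 lemmas -/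
section abs
variable {E : Type*} [AddCommGroup E] [Module ℂ E]

lemma comm_pow (x y h : Module.End ℂ E) (hxy : x * y - y * x = h)
    (hhy : h * y - y * h = (-2 : ℂ) • y) (k : ℕ) :
    x * y ^ (k+1) - y ^ (k+1) * x = ((k:ℂ)+1) • (y ^ k * (h - (k:ℂ) • 1)) := by
  induction k with
  | zero => simp [hxy]
  | succ k ih =>
    have h1 : x * y ^ (k+1+1) - y ^ (k+1+1) * x
      = (x * y ^ (k+1) - y ^ (k+1) * x) * y + y ^ (k+1) * (x * y - y * x) := by
      rw [pow_succ y (k+1)]; noncomm_ring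
    have h2 : h * y = y * h + (-2 : ℂ) • y := by rw [← hhy]; abel
    have h3 : y ^ k * (h - (k:ℂ) • 1) * y = y ^ (k+1) * (h - ((k:ℂ)+2) • 1) := by
      rw [mul_assoc, sub_mul, h2, pow_succ, mul_assoc]
      congr 1
      simp only [mul_sub, smul_mul_assoc, one_mul, mul_smul_comm, mul_one]
      module
    rw [h1, ih, hxy, smul_mul_assoc, h3]
    simp only [mul_sub, mul_smul_comm, mul_one]
    push_cast
    module

lemma comm_yx (x y h : Module.End ℂ E) 
    (hhy : h * y - y * h = (-2 : ℂ) • y) (hhx : h * x - x * h = (2 : ℂ) • x) :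
    h * (y * x) = y * x * h := by
  have h2 : h * y = y * h + (-2 : ℂ) • y := by rw [← hhy]; abel
  have h3 : h * x = x * h + (2 : ℂ) • x := by rw [← hhx]; abel
  rw [← mul_assoc, h2, add_mul, mul_assoc, h3, mul_add, smul_mul_assoc, mul_smul_comm, mul_assoc]
  module

lemma sl2_inj (x y h : Module.End ℂ E) (hxy : x * y - y * x = h)
    (hhy : h * y - y * h = (-2 : ℂ) • y) (hhx : h * x - x * h = (2 : ℂ) • x)
    (U : Submodule ℂ E) (hU : ∀ u ∈ U, h u ∈ U)
    (hk : ∀ k : ℕ, ∀ u ∈ U, h u = (k:ℂ) • u → u = 0) (hN : IsNilpotent y) :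
    ∀ z ∈ U, y (x z) = 0 → z = 0 := by
  obtain ⟨N, hN⟩ := hN
  have key : ∀ k : ℕ, ∀ z ∈ U, y (x z) = 0 → (y ^ k) z = 0 → z = 0 := by
    intro k
    induction k with
    | zero => intro z _ _ hz; simpa using hz
    | succ k ih =>
      intro z hz hyx hy
      have hz' : h z - (k:ℂ) • z = 0 := by
        apply ih
        · exact U.sub_mem (hU z hz) (U.smul_mem _ hz)
        · have := congrArg (fun f => f z) (comm_yx x y h hhy hhx)
          simp only [Module.End.mul_apply] at this
          simp [map_sub, hyx, ← this]
        · have := congrArg (fun f => f z) (comm_pow x y h hxy hhy k)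
          simp only [Module.End.mul_apply, LinearMap.sub_apply, LinearMap.smul_apply, hy,
            Module.End.one_apply] at this
          rw [pow_succ, Module.End.mul_apply, hyx, map_zero, map_zero, sub_zero] at this
          exact (smul_eq_zero.mp this.symm).resolve_left (by exact_mod_cast Nat.succ_ne_zero k)
      exact hk k z hz (sub_eq_zero.mp hz')
  intro z hz hyx
  exact key N z hz hyx (by simp [hN])

lemma sl2_surj [FiniteDimensional ℂ E] (x y h : Module.End ℂ E) (hxy : x * y - y * x = h)
    (hhy : h * y - y * h = (-2 : ℂ) • y) (hhx : h * x - x * h = (2 : ℂ) • x)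
    (U : Submodule ℂ E) (hU : ∀ u ∈ U, h u ∈ U)
    (hk : ∀ k : ℕ, ∀ u ∈ U, h u = (k:ℂ) • u → u = 0) (hN : IsNilpotent y)
    (hyx : ∀ u ∈ U, y (x u) ∈ U) :
    ∀ v ∈ U, ∃ z ∈ U, y (x z) = v := by
  let f : U →ₗ[ℂ] U := (y * x).restrict hyx
  have hf : Function.Injective f := by
    rw [injective_iff_map_eq_zero]
    intro z hz
    have : y (x z) = 0 := congrArg Subtype.val hz
    exact Subtype.ext (sl2_inj x y h hxy hhy hhx U hU hk hN z z.2 this)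
  intro v hv
  obtain ⟨z, hz⟩ := (LinearMap.injective_iff_surjective.mp hf) ⟨v, hv⟩
  exact ⟨z, z.2, congrArg Subtype.val hz⟩

lemma swap_rel (x y h : Module.End ℂ E) (hxy : x * y - y * x = h)
    (hhy : h * y - y * h = (-2 : ℂ) • y) (hhx : h * x - x * h = (2 : ℂ) • x) :
    y * x - x * y = -h ∧ (-h) * x - x * (-h) = (-2 : ℂ) • x ∧
      (-h) * y - y * (-h) = (2 : ℂ) • y := by
  refine ⟨by rw [← hxy]; abel, ?_, ?_⟩
  · ext v
    have := congrArg (fun f => f v) hhx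
    simp only [LinearMap.sub_apply, Module.End.mul_apply, LinearMap.neg_apply, map_neg,
      LinearMap.smul_apply] at this ⊢
    rw [neg_smul, ← this]; abel
  · ext v
    have := congrArg (fun f => f v) hhy
    simp only [LinearMap.sub_apply, Module.End.mul_apply, LinearMap.neg_apply, map_neg,
      LinearMap.smul_apply] at this ⊢
    rw [neg_smul, ← neg_eq_iff_eq_neg] at this
    rw [← this]; abel

lemma sl2_inj_swap (x y h : Module.End ℂ E) (hxy : x * y - y * x = h)
    (hhy : h * y - y * h = (-2 : ℂ) • y) (hhx : h * x - x * h = (2 : ℂ) • x)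
    (U : Submodule ℂ E) (hU : ∀ u ∈ U, h u ∈ U)
    (hk : ∀ k : ℕ, ∀ u ∈ U, h u = -(k:ℂ) • u → u = 0) (hN : IsNilpotent x) :
    ∀ z ∈ U, x (y z) = 0 → z = 0 := by
  obtain ⟨h1, h2, h3⟩ := swap_rel x y h hxy hhy hhx
  refine sl2_inj y x (-h) h1 h2 h3 U (fun u hu => U.neg_mem (hU u hu)) ?_ hN
  intro k u hu hh
  apply hk k u hu
  rw [neg_smul, ← hh, LinearMap.neg_apply, neg_neg]

lemma sl2_surj_swap [FiniteDimensional ℂ E] (x y h : Module.End ℂ E) (hxy : x * y - y * x = h)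
    (hhy : h * y - y * h = (-2 : ℂ) • y) (hhx : h * x - x * h = (2 : ℂ) • x)
    (U : Submodule ℂ E) (hU : ∀ u ∈ U, h u ∈ U)
    (hk : ∀ k : ℕ, ∀ u ∈ U, h u = -(k:ℂ) • u → u = 0) (hN : IsNilpotent x)
    (hyx : ∀ u ∈ U, x (y u) ∈ U) :
    ∀ v ∈ U, ∃ z ∈ U, x (y z) = v := by
  obtain ⟨h1, h2, h3⟩ := swap_rel x y h hxy hhy hhx
  refine sl2_surj y x (-h) h1 h2 h3 U (fun u hu => U.neg_mem (hU u hu)) ?_ hN hyx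
  intro k u hu hh
  apply hk k u hu
  rw [neg_smul, ← hh, LinearMap.neg_apply, neg_neg]

lemma nilp [FiniteDimensional ℂ E] (h y : Module.End ℂ E) (c : ℂ) (hc : c ≠ 0)
    (hhy : h * y - y * h = c • y) : IsNilpotent y := by
  by_contra hn
  have hne : ∀ k, y ^ k ≠ 0 := fun k hk => hn ⟨k, hk⟩
  let ad : Module.End ℂ (Module.End ℂ E) := LinearMap.mulLeft ℂ h - LinearMap.mulRight ℂ h
  have h2 : h * y = y * h + c • y := by rw [← hhy]; abel
  have hpow : ∀ k : ℕ, h * y ^ k = y ^ k * h + ((k:ℂ) * c) • y ^ k := by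
    intro k
    induction k with
    | zero => simp
    | succ k ih =>
      rw [pow_succ, ← mul_assoc, ih, add_mul, mul_assoc, h2, mul_add, smul_mul_assoc,
        mul_smul_comm, mul_assoc]
      push_cast; module
  have hev : ∀ k : ℕ, Module.End.HasEigenvalue ad ((k:ℂ) * c) := by
    intro k
    apply Module.End.hasEigenvalue_of_hasEigenvector (x := y ^ k)
    refine ⟨?_, hne k⟩
    rw [Module.End.mem_eigenspace_iff]
    simp [ad, hpow k]
  have hfin := Module.End.finite_hasEigenvalue ad
  have : Set.range (fun k : ℕ => (k:ℂ) * c) ⊆ ad.HasEigenvalue := by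
    rintro _ ⟨k, rfl⟩; exact hev k
  have hinf : (Set.range (fun k : ℕ => (k:ℂ) * c)).Infinite := by
    apply Set.infinite_range_of_injective
    intro a b hab
    exact_mod_cast mul_right_cancel₀ hc hab
  exact hinf (hfin.subset this)

end abs
end SliceProof

namespace SliceProof
open Matrix

/-! ### Filtration on matrices -/
section filt
set_option linter.unusedSectionVars false
variable {ι : Type*} [Fintype ι] [DecidableEq ι]

/-- matrices of degree at most `m` -/
def Dg (w : ι → ℤ) (m : ℤ) : Submodule ℂ (Matrix ι ι ℂ) where
  carrier := {A | ∀ a b, m < w a - w b → A a b = 0}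
  add_mem' := by
    intro A B hA hB a b h
    simp [hA a b h, hB a b h]
  zero_mem' := by intro a b _; rfl
  smul_mem' := by
    intro c A hA a b h
    simp [hA a b h]

/-- matrices of positive degree -/
def Dpos (w : ι → ℤ) : Submodule ℂ (Matrix ι ι ℂ) where
  carrier := {A | ∀ a b, w a - w b ≤ 0 → A a b = 0}
  add_mem' := by
    intro A B hA hB a b h
    simp [hA a b h, hB a b h]
  zero_mem' := by intro a b _; rfl
  smul_mem' := by
    intro c A hA a b h
    simp [hA a b h]

variable {w : ι → ℤ}

lemma mem_Dg {m : ℤ} {A : Matrix ι ι ℂ} : A ∈ Dg w m ↔ ∀ a b, m < w a - w b → A a b = 0 :=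
  Iff.rfl

lemma Dg_mono {m m' : ℤ} (h : m ≤ m') {A : Matrix ι ι ℂ} (hA : A ∈ Dg w m) : A ∈ Dg w m' :=
  fun a b hab => hA a b (by omega)

lemma Dg_mul {m m' k : ℤ} {A B : Matrix ι ι ℂ} (hA : A ∈ Dg w m) (hB : B ∈ Dg w m')
    (hk : m + m' ≤ k) : A * B ∈ Dg w k := by
  intro a b hab
  rw [Matrix.mul_apply]
  apply Finset.sum_eq_zero
  intro c _
  by_cases h : m < w a - w c
  · rw [hA a c h, zero_mul]
  · rw [hB c b (by omega), mul_zero]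

lemma Dg_diag (d : ι → ℂ) : Matrix.diagonal d ∈ Dg w 0 := by
  intro a b hab
  apply Matrix.diagonal_apply_ne
  rintro rfl; omega

lemma Dg_one : (1 : Matrix ι ι ℂ) ∈ Dg w 0 := by
  rw [← Matrix.diagonal_one]; exact Dg_diag _

lemma Dg_pow {A : Matrix ι ι ℂ} (hA : A ∈ Dg w (-1)) (k : ℕ) : A ^ k ∈ Dg w (-(k:ℤ)) := by
  induction k with
  | zero => simpa using Dg_one
  | succ k ih => rw [pow_succ]; exact Dg_mul ih hA (by push_cast; omega)

lemma exists_bound (w : ι → ℤ) : ∃ K : ℕ, ∀ A : Matrix ι ι ℂ, A ∈ Dg w (-(K:ℤ)) → A = 0 := by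
  obtain ⟨B, hB⟩ : ∃ B : ℕ, ∀ a, |w a| ≤ B := by
    refine ⟨∑ a, (w a).natAbs, fun a => ?_⟩
    rw [Int.abs_eq_natAbs]
    exact_mod_cast Finset.single_le_sum (f := fun a => (w a).natAbs) (fun _ _ => Nat.zero_le _) (Finset.mem_univ a)
  refine ⟨2 * B + 1, fun A hA => ?_⟩
  ext a b
  apply hA
  have h1 := abs_le.mp (hB a)
  have h2 := abs_le.mp (hB b)
  push_cast
  omega

/-- inverse of a unipotent -/
lemma unip_inv {A : Matrix ι ι ℂ} (hA : A ∈ Dg w (-1)) :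
    ∃ B ∈ Dg w (-1), (1 + A) * (1 + B) = 1 ∧ (1 + B) * (1 + A) = 1 := by
  obtain ⟨K, hK⟩ := exists_bound w
  have hA0 : (-A) ^ K = 0 := hK _ (Dg_pow ((Dg w (-1)).neg_mem hA) K)
  let G : Matrix ι ι ℂ := ∑ k ∈ Finset.range K, (-A) ^ k
  have hG0 : G ∈ Dg w 0 := by
    refine Submodule.sum_mem _ fun k _ => ?_
    exact Dg_mono (by omega) (Dg_pow ((Dg w (-1)).neg_mem hA) k)
  have h1 : G * (-A - 1) = (-A) ^ K - 1 := geom_sum_mul (-A) K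
  have h2 : (1 + A) * G = 1 := by
    have h1 : (-A - 1) * G = (-A) ^ K - 1 := mul_geom_sum (-A) K
    rw [hA0] at h1
    have : (1 + A) * G = - ((-A - 1) * G) := by noncomm_ring
    rw [this, h1]; simp
  have h3 : G * (1 + A) = 1 := by
    rw [hA0] at h1
    have : G * (1 + A) = - (G * (-A - 1)) := by noncomm_ring
    rw [this, h1]; simp
  refine ⟨- (A * G), (Dg w (-1)).neg_mem (Dg_mul hA hG0 (by omega)), ?_⟩
  have : 1 + -(A * G) = G := by
    nth_rewrite 1 [← h2]
    noncomm_ring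
  rw [this]; exact ⟨h2, h3⟩

/-- the adjoint operator -/
noncomputable def ad (A : Matrix ι ι ℂ) : Module.End ℂ (Matrix ι ι ℂ) :=
  LinearMap.mulLeft ℂ A - LinearMap.mulRight ℂ A

lemma ad_apply (A B : Matrix ι ι ℂ) : ad A B = A * B - B * A := rfl

lemma ad_comm (A B : Matrix ι ι ℂ) : ad A * ad B - ad B * ad A = ad (A * B - B * A) := by
  ext1 Z
  simp only [LinearMap.sub_apply, Module.End.mul_apply, ad_apply]
  noncomm_ring

lemma ad_smul (c : ℂ) (A : Matrix ι ι ℂ) : ad (c • A) = c • ad A := by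
  ext1 Z
  simp [ad_apply, smul_sub]

lemma ad_diag (d : ι → ℂ) (A : Matrix ι ι ℂ) (a b : ι) :
    ad (Matrix.diagonal d) A a b = (d a - d b) * A a b := by
  simp [ad_apply, Matrix.diagonal_mul, Matrix.mul_diagonal]; ring

variable {X Y : Matrix ι ι ℂ}

/-- The data of a graded triple. -/
structure Trip (w : ι → ℤ) (X Y : Matrix ι ι ℂ) : Prop where
  hx : ad (Matrix.diagonal fun a => (w a : ℂ)) X = (2 : ℂ) • X
  hy : ad (Matrix.diagonal fun a => (w a : ℂ)) Y = (-2 : ℂ) • Y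
  xy : X * Y - Y * X = Matrix.diagonal fun a => (w a : ℂ)

lemma Trip.Xdeg (T : Trip w X Y) : X ∈ Dg w 2 := by
  intro a b hab
  have := congrFun (congrFun T.hx a) b
  rw [ad_diag, Matrix.smul_apply, smul_eq_mul, ← sub_eq_zero, ← sub_mul] at this
  refine (mul_eq_zero.mp this).resolve_left ?_
  intro h
  have : (w a - w b - 2 : ℤ) = 0 := by exact_mod_cast h
  omega

lemma Trip.Yhom (T : Trip w X Y) (a b : ι) (hab : w a - w b ≠ -2) : Y a b = 0 := by
  have := congrFun (congrFun T.hy a) b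
  rw [ad_diag, Matrix.smul_apply, smul_eq_mul, ← sub_eq_zero, ← sub_mul] at this
  refine (mul_eq_zero.mp this).resolve_left ?_
  intro h
  apply hab
  have : ((w a - w b : ℤ) : ℂ) = ((-2 : ℤ) : ℂ) := by push_cast; linear_combination h
  exact_mod_cast this

lemma Trip.Ydeg (T : Trip w X Y) : Y ∈ Dg w (-2) :=
  fun a b hab => T.Yhom a b (by omega)

lemma Trip.adxy (T : Trip w X Y) :
    ad X * ad Y - ad Y * ad X = ad (Matrix.diagonal fun a => (w a : ℂ)) := by
  rw [ad_comm, T.xy]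

lemma Trip.adhx (T : Trip w X Y) :
    ad (Matrix.diagonal fun a => (w a : ℂ)) * ad X - ad X * ad (Matrix.diagonal fun a => (w a : ℂ))
      = (2:ℂ) • ad X := by
  rw [ad_comm, ← ad_apply, T.hx, ad_smul]

lemma Trip.adhy (T : Trip w X Y) :
    ad (Matrix.diagonal fun a => (w a : ℂ)) * ad Y - ad Y * ad (Matrix.diagonal fun a => (w a : ℂ))
      = (-2:ℂ) • ad Y := by
  rw [ad_comm, ← ad_apply, T.hy, ad_smul]

lemma Dg_adh {m : ℤ} (d : ι → ℂ) {A : Matrix ι ι ℂ} (hA : A ∈ Dg w m) :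
    ad (Matrix.diagonal d) A ∈ Dg w m := by
  intro a b hab
  rw [ad_diag, hA a b hab, mul_zero]

lemma Dg_ad {m m' k : ℤ} {A B : Matrix ι ι ℂ} (hA : A ∈ Dg w m) (hB : B ∈ Dg w m')
    (hk : m + m' ≤ k) : ad A B ∈ Dg w k :=
  (Dg w k).sub_mem (Dg_mul hA hB hk) (Dg_mul hB hA (by omega))

lemma Dg_noeig {m : ℤ} (hm : m < 0) (k : ℕ) (A : Matrix ι ι ℂ) (hA : A ∈ Dg w m)
    (h : ad (Matrix.diagonal fun a => (w a : ℂ)) A = (k:ℂ) • A) : A = 0 := by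
  ext a b
  have := congrFun (congrFun h a) b
  rw [ad_diag, Matrix.smul_apply, smul_eq_mul, ← sub_eq_zero, ← sub_mul] at this
  rcases mul_eq_zero.mp this with h | h
  · apply hA
    have : (w a - w b - k : ℤ) = 0 := by exact_mod_cast h
    omega
  · exact h

lemma Trip.inj (T : Trip w X Y) {m : ℤ} (hm : m < 0) (Z : Matrix ι ι ℂ) (hZ : Z ∈ Dg w m)
    (h : ad Y (ad X Z) = 0) : Z = 0 :=
  sl2_inj (ad X) (ad Y) _ T.adxy T.adhy T.adhx (Dg w m) (fun _ hu => Dg_adh _ hu)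
    (fun k u hu => Dg_noeig hm k u hu) (nilp _ _ (-2) (by norm_num) T.adhy) Z hZ h

lemma Trip.surj (T : Trip w X Y) {m : ℤ} (hm : m < 0) (Z : Matrix ι ι ℂ) (hZ : Z ∈ Dg w m) :
    ∃ A ∈ Dg w m, ad Y (ad X A) = Z :=
  sl2_surj (ad X) (ad Y) _ T.adxy T.adhy T.adhx (Dg w m) (fun _ hu => Dg_adh _ hu)
    (fun k u hu => Dg_noeig hm k u hu) (nilp _ _ (-2) (by norm_num) T.adhy)
    (fun u hu => Dg_ad T.Ydeg (Dg_ad T.Xdeg hu le_rfl) (by omega)) Z hZ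

lemma Trip.lower (T : Trip w X Y) {m : ℤ} (hm : m < 0) (Z : Matrix ι ι ℂ) (hZ : Z ∈ Dg w m)
    (h : ad Y (ad X Z) ∈ Dg w (m-1)) : Z ∈ Dg w (m-1) := by
  obtain ⟨A, hA, hAZ⟩ := T.surj (m := m-1) (by omega) _ h
  have : Z - A = 0 := T.inj hm (Z - A) ((Dg w m).sub_mem hZ (Dg_mono (by omega) hA)) (by
    rw [map_sub, map_sub, hAZ, sub_self])
  rw [sub_eq_zero.mp this]; exact hA

lemma Trip.cdeg (T : Trip w X Y) (C : Matrix ι ι ℂ) (hC : C * Y = Y * C) : C ∈ Dg w 0 := by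
  let P : Matrix ι ι ℂ := fun a b => if 0 < w a - w b then C a b else 0
  have hP : P ∈ Dpos w := by
    intro a b hab
    simp only [P]; rw [if_neg (by omega)]
  have hYP : ad Y P = 0 := by
    ext a c
    have h1 : ad Y P a c = if -2 < w a - w c then ad Y C a c else 0 := by
      simp only [ad_apply, Matrix.sub_apply, Matrix.mul_apply]
      rw [← Finset.sum_sub_distrib, ← Finset.sum_sub_distrib]
      split_ifs with h
      · apply Finset.sum_congr rfl
        intro b _
        congr 1
        · by_cases hab : w a - w b = -2
          · simp only [P]; rw [if_pos (by omega)]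
          · rw [T.Yhom a b hab, zero_mul, zero_mul]
        · by_cases hab : w b - w c = -2
          · simp only [P]; rw [if_pos (by omega)]
          · rw [T.Yhom b c hab, mul_zero, mul_zero]
      · apply Finset.sum_eq_zero
        intro b _
        have e1 : Y a b * P b c = 0 := by
          by_cases hab : w a - w b = -2
          · simp only [P]; rw [if_neg (by omega), mul_zero]
          · rw [T.Yhom a b hab, zero_mul]
        have e2 : P a b * Y b c = 0 := by
          by_cases hab : w b - w c = -2
          · simp only [P]; rw [if_neg (by omega), zero_mul]
          · rw [T.Yhom b c hab, mul_zero]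
        rw [e1, e2, sub_zero]
    rw [h1, ad_apply, hC, sub_self]
    simp
  have hP0 : P = 0 := by
    refine sl2_inj_swap (ad X) (ad Y) _ T.adxy T.adhy T.adhx (Dpos w)
      ?_ ?_ (nilp _ _ 2 (by norm_num) T.adhx) P hP (by rw [hYP, map_zero])
    · intro u hu a b hab
      rw [ad_diag, hu a b hab, mul_zero]
    · intro k u hu h
      ext a b
      have := congrFun (congrFun h a) b
      rw [ad_diag, Matrix.smul_apply, smul_eq_mul, ← sub_eq_zero, ← sub_mul] at this
      rcases mul_eq_zero.mp this with h | h
      · apply hu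
        have : (w a - w b - -k : ℤ) = 0 := by exact_mod_cast h
        omega
      · exact h
  intro a b hab
  have := congrFun (congrFun hP0 a) b
  simp only [P, if_pos hab] at this
  exact this

/-- uniqueness in the slice up to the unipotent group -/
lemma Trip.uniq (T : Trip w X Y) (C C' A : Matrix ι ι ℂ) (hC : C * Y = Y * C)
    (hC' : C' * Y = Y * C') (hA : A ∈ Dg w (-1)) (h : (1 + A) * (X + C) = (X + C') * (1 + A)) :
    C = C' := by
  have dC := T.cdeg C hC
  have dC' := T.cdeg C' hC'
  have hXA : ad X A = C - C' + (A * C - C' * A) := by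
    have : ad X A - (C - C' + (A * C - C' * A)) = (X + C') * (1 + A) - (1 + A) * (X + C) := by
      rw [ad_apply]; noncomm_ring
    rw [← sub_eq_zero, this, h, sub_self]
  have hYXA : ad Y (ad X A) = ad Y (A * C - C' * A) := by
    rw [hXA, map_add]
    have : ad Y (C - C') = 0 := by rw [ad_apply, mul_sub, sub_mul, hC, hC', sub_self]
    rw [this, zero_add]
  have key : ∀ k : ℕ, A ∈ Dg w (-1 - (k:ℤ)) := by
    intro k
    induction k with
    | zero => simpa using hA
    | succ k ih =>
      have := T.lower (m := -1 - (k:ℤ)) (by omega) A ih (by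
        rw [hYXA]
        refine Dg_ad (m' := -1 - (k:ℤ)) T.Ydeg ?_ (by omega)
        exact Submodule.sub_mem _ (Dg_mul ih dC (by omega)) (Dg_mul dC' ih (by omega)))
      exact Dg_mono (by push_cast; omega) this
  obtain ⟨K, hK⟩ := exists_bound w
  have hA0 : A = 0 := hK A (Dg_mono (by omega) (key K))
  subst hA0
  simpa using h

/-- moving into the slice -/
lemma Trip.exist (T : Trip w X Y) (D : Matrix ι ι ℂ) (hD : D ∈ Dg w 0) :
    ∃ A ∈ Dg w (-1), ∃ C, C * Y = Y * C ∧ (1 + A) * (X + D) = (X + C) * (1 + A) := by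
  have key : ∀ k : ℕ, ∃ A ∈ Dg w (-1), ∃ C, ∃ R ∈ Dg w (-(k:ℤ)), C * Y = Y * C ∧
      (1 + A) * (X + D) = (X + C + R) * (1 + A) := by
    intro k
    induction k with
    | zero => exact ⟨0, Submodule.zero_mem _, 0, D, by simpa using hD, by simp, by simp⟩
    | succ k ih =>
      obtain ⟨A, hA, C, R, hR, hC, h⟩ := ih
      have dC := T.cdeg C hC
      obtain ⟨z, hz, hzR⟩ := T.surj (m := -(k:ℤ) - 2) (by omega) (ad Y R)
        (Dg_ad T.Ydeg hR (by omega))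
      obtain ⟨z', hz', hzz, hzz'⟩ := unip_inv (A := z) (w := w) (Dg_mono (by omega) hz)
      have dz' : 1 + z' ∈ Dg w 0 := Submodule.add_mem _ Dg_one (Dg_mono (by omega) hz')
      have dC2 : R - ad X z ∈ Dg w (-(k:ℤ)) :=
        Submodule.sub_mem _ hR (Dg_ad T.Xdeg hz (by omega))
      have hC2 : ad Y (R - ad X z) = 0 := by rw [map_sub, hzR, sub_self]
      have hC2' : (R - ad X z) * Y = Y * (R - ad X z) := (sub_eq_zero.mp hC2).symm
      let W := z * (C + R) - (C + (R - ad X z)) * z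
      have hW : W ∈ Dg w (-((k+1:ℕ):ℤ)) := by
        refine Submodule.sub_mem _ (Dg_mul hz (m' := 0) ?_ (by push_cast; omega))
          (Dg_mul (m := 0) ?_ hz (by push_cast; omega))
        · exact Submodule.add_mem _ dC (Dg_mono (by omega) hR)
        · exact Submodule.add_mem _ dC (Dg_mono (by omega) dC2)
      have hstep : (1 + z) * (X + C + R) = (X + (C + (R - ad X z)) + W * (1 + z')) * (1 + z) := by
        rw [add_mul _ (W * (1 + z')), mul_assoc W, hzz', mul_one]
        simp only [W, ad_apply]
        noncomm_ring
      refine ⟨A + z + z * A, ?_, C + (R - ad X z), W * (1 + z'), Dg_mul hW dz' (by omega), ?_, ?_⟩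
      · refine Submodule.add_mem _ (Submodule.add_mem _ hA (Dg_mono (by omega) hz)) ?_
        exact Dg_mul hz hA (by omega)
      · rw [add_mul, mul_add, hC, hC2']
      · have e : 1 + (A + z + z * A) = (1 + z) * (1 + A) := by noncomm_ring
        rw [e, mul_assoc, h, ← mul_assoc, hstep, mul_assoc]
  obtain ⟨K, hK⟩ := exists_bound w
  obtain ⟨A, hA, C, R, hR, hC, h⟩ := key K
  refine ⟨A, hA, C, hC, ?_⟩
  rw [hK R hR, add_zero] at h
  exact h

end filt
end SliceProof

namespace SliceProof
open Matrix

/-- A finite set arranged in blocks (Jordan strings). -/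
structure Blk (ι J : Type*) where
  bl : ι → J
  lev : ι → ℕ
  len : J → ℕ
  inj : ∀ a b, bl a = bl b → lev a = lev b → a = b
  lt : ∀ a, lev a < len (bl a)
  ex : ∀ a i, i < len (bl a) → ∃ b, bl b = bl a ∧ lev b = i

section blk
set_option linter.unusedSectionVars false
variable {ι J : Type*} [Fintype ι] [DecidableEq ι] (B : Blk ι J)

/-- weight -/
def Blk.w (a : ι) : ℤ := 2 * (B.lev a : ℤ) + 1 - B.len (B.bl a)

open Classical in
/-- shift by `k` -/
noncomputable def Blk.sh (k : ℕ) : Matrix ι ι ℂ :=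
  fun a b => if B.bl a = B.bl b ∧ B.lev a = B.lev b + k then 1 else 0

lemma Blk.sh_zero : B.sh 0 = 1 := by
  ext a b
  by_cases h : a = b
  · subst h; simp [Blk.sh]
  · rw [Matrix.one_apply_ne h]
    simp only [Blk.sh]
    rw [if_neg]
    rintro ⟨h1, h2⟩
    exact h (B.inj a b h1 (by simpa using h2))

lemma Blk.sh_mul (k l : ℕ) : B.sh k * B.sh l = B.sh (k + l) := by
  classical
  ext a b
  rw [Matrix.mul_apply]
  by_cases h : B.bl a = B.bl b ∧ B.lev a = B.lev b + (k + l)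
  · obtain ⟨c, hc1, hc2⟩ := B.ex b (B.lev b + l) (by
      have := B.lt a; rw [h.1] at this; omega)
    rw [Finset.sum_eq_single c]
    · simp only [Blk.sh]
      rw [if_pos h, if_pos ⟨h.1.trans hc1.symm, by omega⟩, if_pos ⟨hc1, hc2⟩, one_mul]
    · intro d _ hd
      simp only [Blk.sh]
      by_cases h2 : B.bl d = B.bl b ∧ B.lev d = B.lev b + l
      · exact absurd (B.inj d c (h2.1.trans hc1.symm) (by omega)) hd
      · rw [if_neg h2, mul_zero]
    · simp
  · have : B.sh (k + l) a b = 0 := by simp only [Blk.sh]; rw [if_neg h]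
    rw [this]
    apply Finset.sum_eq_zero
    intro c _
    simp only [Blk.sh]
    by_cases h1 : B.bl a = B.bl c ∧ B.lev a = B.lev c + k
    · by_cases h2 : B.bl c = B.bl b ∧ B.lev c = B.lev b + l
      · exact absurd ⟨h1.1.trans h2.1, by omega⟩ h
      · rw [if_neg h2, mul_zero]
    · rw [if_neg h1, zero_mul]

lemma Blk.sh_pow (k : ℕ) : B.sh 1 ^ k = B.sh k := by
  induction k with
  | zero => rw [pow_zero, B.sh_zero]
  | succ k ih => rw [pow_succ, ih, B.sh_mul]

lemma Blk.sh_deg (k : ℕ) : B.sh k ∈ Dg B.w (2 * k) := by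
  intro a b hab
  simp only [Blk.sh]
  rw [if_neg]
  rintro ⟨h1, h2⟩
  simp only [Blk.w, h1, h2] at hab
  push_cast at hab
  omega

lemma Blk.shT_deg (k : ℕ) : (B.sh k)ᵀ ∈ Dg B.w (-(2 * k)) := by
  intro a b hab
  simp only [Blk.sh, Matrix.transpose_apply]
  rw [if_neg]
  rintro ⟨h1, h2⟩
  simp only [Blk.w, h1, h2] at hab
  push_cast at hab
  omega

lemma Blk.sh_shT (k : ℕ) :
    B.sh k * (B.sh k)ᵀ = Matrix.diagonal (fun a => if k ≤ B.lev a then (1:ℂ) else 0) := by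
  classical
  ext a b
  rw [Matrix.mul_apply]
  by_cases hab : a = b
  · subst hab
    rw [Matrix.diagonal_apply_eq]
    split_ifs with h
    · obtain ⟨c, hc1, hc2⟩ := B.ex a (B.lev a - k) (by have := B.lt a; omega)
      rw [Finset.sum_eq_single c]
      · simp only [Blk.sh, Matrix.transpose_apply]
        rw [if_pos ⟨hc1.symm, by omega⟩, one_mul]
      · intro d _ hd
        simp only [Blk.sh]
        rw [if_neg, zero_mul]
        rintro ⟨h1, h2⟩
        exact hd (B.inj d c (by rw [hc1, h1]) (by omega))
      · simp
    · apply Finset.sum_eq_zero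
      intro c _
      simp only [Blk.sh]
      rw [if_neg, zero_mul]
      rintro ⟨h1, h2⟩; omega
  · rw [Matrix.diagonal_apply_ne _ hab]
    apply Finset.sum_eq_zero
    intro c _
    simp only [Blk.sh, Matrix.transpose_apply]
    by_cases h1 : B.bl a = B.bl c ∧ B.lev a = B.lev c + k
    · by_cases h2 : B.bl b = B.bl c ∧ B.lev b = B.lev c + k
      · exact absurd (B.inj a b (h1.1.trans h2.1.symm) (by omega)) hab
      · rw [if_neg h2, mul_zero]
    · rw [if_neg h1, zero_mul]

lemma Blk.sh_shT_sh (k : ℕ) : B.sh k * (B.sh k)ᵀ * B.sh k = B.sh k := by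
  rw [B.sh_shT]
  ext a b
  rw [Matrix.diagonal_mul]
  simp only [Blk.sh]
  by_cases h1 : B.bl a = B.bl b ∧ B.lev a = B.lev b + k
  · rw [if_pos h1, if_pos (by omega), one_mul]
  · rw [if_neg h1, mul_zero]

lemma Blk.rank_sh (k : ℕ) :
    (B.sh k).rank = (Finset.univ.filter fun a => k ≤ B.lev a).card := by
  have h1 : (B.sh k).rank = (B.sh k * (B.sh k)ᵀ).rank := by
    apply le_antisymm
    · conv_lhs => rw [← B.sh_shT_sh k]
      exact Matrix.rank_mul_le_left _ _
    · exact Matrix.rank_mul_le_left _ _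
  rw [h1, B.sh_shT, Matrix.rank_diagonal, Fintype.card_subtype]
  congr 1
  ext a
  simp

/-- product `(M - e (i-1)) ⋯ (M - e 0)` -/
noncomputable def Pm (e : ℕ → ℂ) (M : Matrix ι ι ℂ) : ℕ → Matrix ι ι ℂ
  | 0 => 1
  | i+1 => (M - e i • 1) * Pm e M i

lemma Pm_conj (e : ℕ → ℂ) (g : (Matrix ι ι ℂ)ˣ) (M : Matrix ι ι ℂ) (i : ℕ) :
    Pm e ((g : Matrix ι ι ℂ) * M * (↑g⁻¹ : Matrix ι ι ℂ)) i
      = (g : Matrix ι ι ℂ) * Pm e M i * (↑g⁻¹ : Matrix ι ι ℂ) := by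
  induction i with
  | zero => simp [Pm]
  | succ i ih =>
    simp only [Pm]
    have : (g : Matrix ι ι ℂ) * M * (↑g⁻¹ : Matrix ι ι ℂ) - e i • 1
      = (g : Matrix ι ι ℂ) * (M - e i • 1) * (↑g⁻¹ : Matrix ι ι ℂ) := by
      rw [mul_sub, sub_mul, mul_smul_comm, mul_one, smul_mul_assoc, Units.mul_inv]
    rw [ih, this]
    simp only [mul_assoc]
    rw [Units.inv_mul_cancel_left]

lemma Pm_diag (e : ℕ → ℂ) (d : ι → ℂ) (i : ℕ) :
    Pm e (Matrix.diagonal d) i = Matrix.diagonal (fun a => ∏ k ∈ Finset.range i, (d a - e k)) := by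
  induction i with
  | zero => simp [Pm]
  | succ i ih =>
    simp only [Pm]
    rw [ih, Matrix.smul_one_eq_diagonal, Matrix.diagonal_sub, Matrix.diagonal_mul_diagonal]
    congr 1
    ext a
    rw [Finset.prod_range_succ, mul_comm]

lemma Blk.Pm_deg (e : ℕ → ℂ) (C : Matrix ι ι ℂ) (hC : C ∈ Dg B.w 0) (i : ℕ) :
    Pm e (B.sh 1 + C) i - B.sh i ∈ Dg B.w (2 * i - 1) := by
  induction i with
  | zero => rw [B.sh_zero]; simp [Pm]
  | succ i ih =>
    have hP : Pm e (B.sh 1 + C) i ∈ Dg B.w (2 * i) := by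
      have := (Dg B.w (2 * i)).add_mem (Dg_mono (by omega) ih) (B.sh_deg i)
      simpa using this
    have : Pm e (B.sh 1 + C) (i+1) - B.sh (i+1) =
      B.sh 1 * (Pm e (B.sh 1 + C) i - B.sh i) + (C - e i • 1) * Pm e (B.sh 1 + C) i := by
      rw [add_comm i 1, ← B.sh_mul, add_comm 1 i]
      simp only [Pm]
      noncomm_ring
    rw [this]
    refine Submodule.add_mem _ (Dg_mul (B.sh_deg 1) ih (by push_cast; omega)) ?_
    refine Dg_mul (m := 0) ?_ hP (by push_cast; omega)
    exact Submodule.sub_mem _ hC (Submodule.smul_mem _ _ Dg_one)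

/-- every element of `X + (degree ≤ 0)` in the orbit has generators killed by `Pm`. -/
lemma Blk.gen (e : ℕ → ℂ) (C : Matrix ι ι ℂ) (hC : C ∈ Dg B.w 0) (g : (Matrix ι ι ℂ)ˣ)
    (hM : B.sh 1 + C = (g : Matrix ι ι ℂ) * Matrix.diagonal (fun a => e (B.lev a)) *
      (↑g⁻¹ : Matrix ι ι ℂ)) (p : ℕ) :
    ∃ V ∈ Dg B.w (-1), ∀ v : ι → ℂ, B.sh p *ᵥ v = 0 →
      Pm e (B.sh 1 + C) p *ᵥ ((1 + V) *ᵥ v) = 0 := by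
  set A := Pm e (B.sh 1 + C) p with hA
  have dR := B.Pm_deg e C hC p
  have dZ : (B.sh p)ᵀ * (A - B.sh p) ∈ Dg B.w (-1) := Dg_mul (B.shT_deg p) dR (by omega)
  obtain ⟨V, hV, hV1, hV2⟩ := unip_inv dZ
  refine ⟨V, hV, fun v hv => ?_⟩
  set u := 1 + (B.sh p)ᵀ * (A - B.sh p) with hu
  have hXu : B.sh p * (B.sh p)ᵀ * A = B.sh p * u := by
    rw [hu, mul_add, mul_one, mul_sub, mul_sub, ← mul_assoc, ← mul_assoc, B.sh_shT_sh]
    abel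
  -- rank inequality
  have hrank : A.rank ≤ (B.sh p * u).rank := by
    have h1 : A.rank ≤ (B.sh p).rank := by
      rw [B.rank_sh, hA, hM, Pm_conj, Pm_diag]
      refine (Matrix.rank_mul_le_left _ _).trans ((Matrix.rank_mul_le_right _ _).trans ?_)
      rw [Matrix.rank_diagonal, Fintype.card_subtype]
      apply Finset.card_le_card
      intro a ha
      simp only [Finset.mem_filter, Finset.mem_univ, true_and] at ha ⊢
      by_contra hlt
      apply ha
      exact Finset.prod_eq_zero (Finset.mem_range.mpr (not_le.mp hlt)) (sub_self _)
    refine h1.trans ?_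
    have : B.sh p = B.sh p * u * (1 + V) := by rw [mul_assoc, hV1, mul_one]
    conv_lhs => rw [this]
    exact Matrix.rank_mul_le_left _ _
  have hle : LinearMap.ker A.mulVecLin ≤ LinearMap.ker (B.sh p * u).mulVecLin := by
    intro x hx
    rw [LinearMap.mem_ker, Matrix.mulVecLin_apply] at hx ⊢
    rw [← hXu, ← Matrix.mulVec_mulVec, hx, Matrix.mulVec_zero]
  have heq : LinearMap.ker A.mulVecLin = LinearMap.ker (B.sh p * u).mulVecLin := by
    apply Submodule.eq_of_le_of_finrank_le hle
    have h1 := LinearMap.finrank_range_add_finrank_ker A.mulVecLin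
    have h2 := LinearMap.finrank_range_add_finrank_ker (B.sh p * u).mulVecLin
    simp only [Matrix.rank] at hrank
    omega
  have : (1 + V) *ᵥ v ∈ LinearMap.ker (B.sh p * u).mulVecLin := by
    rw [LinearMap.mem_ker, Matrix.mulVecLin_apply, Matrix.mulVec_mulVec, mul_assoc, hV1, mul_one, hv]
  rw [← heq] at this
  simpa using this

lemma Blk.conj (e : ℕ → ℂ) (C : Matrix ι ι ℂ) (hC : C ∈ Dg B.w 0) (g : (Matrix ι ι ℂ)ˣ)
    (hM : B.sh 1 + C = (g : Matrix ι ι ℂ) * Matrix.diagonal (fun a => e (B.lev a)) *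
      (↑g⁻¹ : Matrix ι ι ℂ)) :
    ∃ A ∈ Dg B.w (-1), (1 + A) * (B.sh 1 + Matrix.diagonal (fun a => e (B.lev a)))
      = (B.sh 1 + C) * (1 + A) := by
  choose V hV hVk using B.gen e C hC g hM
  have hbot : ∀ a, ∃ b, B.bl b = B.bl a ∧ B.lev b = 0 :=
    fun a => B.ex a 0 (lt_of_le_of_lt (Nat.zero_le _) (B.lt a))
  choose z hz1 hz2 using hbot
  have zeq : ∀ a b, B.bl a = B.bl b → z a = z b := fun a b h =>
    B.inj _ _ (by rw [hz1, hz1, h]) (by rw [hz2, hz2])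
  set M := B.sh 1 + C with hMdef
  let Q : ι → Matrix ι ι ℂ := fun b => 1 + V (B.len (B.bl b))
  let N : Matrix ι ι ℂ := fun a b => (Pm e M (B.lev b) * Q b) a (z b)
  refine ⟨N - 1, ?_, ?_⟩
  · intro a b hab
    have h1 : (Pm e M (B.lev b) * Q b) - B.sh (B.lev b) ∈ Dg B.w (2 * (B.lev b) - 1) := by
      have dR := B.Pm_deg e C hC (B.lev b)
      have : (Pm e M (B.lev b) * Q b) - B.sh (B.lev b) =
          (Pm e M (B.lev b) - B.sh (B.lev b)) * Q b + B.sh (B.lev b) * V (B.len (B.bl b)) := by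
        simp only [Q]; noncomm_ring
      rw [this]
      refine Submodule.add_mem _ (Dg_mul dR (m' := 0) ?_ (by omega))
        (Dg_mul (B.sh_deg _) (hV _) (by omega))
      exact Submodule.add_mem _ Dg_one (Dg_mono (by omega) (hV _))
    have h2 := h1 a (z b) (by
      simp only [Blk.w, hz1, hz2] at hab ⊢
      push_cast at hab ⊢
      omega)
    have h3 : B.sh (B.lev b) a (z b) = (1 : Matrix ι ι ℂ) a b := by
      rw [← B.sh_zero]
      simp only [Blk.sh]
      rw [hz1 b, hz2 b, zero_add, add_zero]
    rw [Matrix.sub_apply, h3] at h2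
    rw [Matrix.sub_apply]
    exact h2
  · rw [add_sub_cancel]
    ext a b
    have hL : (M * N) a b = (M * (Pm e M (B.lev b) * Q b)) a (z b) := by
      rw [Matrix.mul_apply, Matrix.mul_apply]
    have hL2 : M * (Pm e M (B.lev b) * Q b) =
        Pm e M (B.lev b + 1) * Q b + e (B.lev b) • (Pm e M (B.lev b) * Q b) := by
      simp only [Pm]
      rw [sub_mul, sub_mul, smul_mul_assoc, one_mul, smul_mul_assoc, mul_assoc]
      abel
    rw [hL, hL2, mul_add, Matrix.add_apply, Matrix.add_apply, Matrix.mul_diagonal,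
      Matrix.smul_apply, smul_eq_mul, mul_comm (N a b)]
    congr 1
    by_cases h : B.lev b + 1 < B.len (B.bl b)
    · obtain ⟨c, hc1, hc2⟩ := B.ex b _ h
      rw [Matrix.mul_apply, Finset.sum_eq_single c]
      · simp only [N, Q, Blk.sh]
        rw [if_pos ⟨hc1, hc2⟩, mul_one, hc1, hc2, zeq c b hc1]
      · intro d _ hd
        simp only [Blk.sh]
        rw [if_neg, mul_zero]
        rintro ⟨h1, h2⟩
        exact hd (B.inj d c (h1.trans hc1.symm) (by omega))
      · simp
    · have hlen : B.len (B.bl b) = B.lev b + 1 := by have := B.lt b; omega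
      have hk := hVk (B.len (B.bl b)) (Pi.single (z b) 1) (by
        rw [Matrix.mulVec_single_one]
        ext d
        simp only [Matrix.col_apply, Blk.sh]
        rw [if_neg]; rfl
        rintro ⟨h1, h2⟩
        rw [hz1] at h1
        rw [hz2] at h2
        have := B.lt d
        rw [h1] at this; omega)
      rw [Matrix.mulVec_mulVec, Matrix.mulVec_single_one] at hk
      have hk2 := congrFun hk a
      rw [Matrix.col_apply] at hk2
      rw [show Q b = 1 + V (B.len (B.bl b)) from rfl, ← hlen, hk2]
      rw [Matrix.mul_apply]
      apply Finset.sum_eq_zero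
      intro d _
      simp only [Blk.sh]
      rw [if_neg, mul_zero]
      rintro ⟨h1, h2⟩
      have := B.lt d
      rw [h1] at this; omega

/-- `X + D` is conjugate to `D`. -/
lemma Blk.diagz (e : ℕ → ℂ) (he : ∀ a, ∀ i < B.lev a, e i ≠ e (B.lev a)) :
    ∃ g : (Matrix ι ι ℂ)ˣ, B.sh 1 + Matrix.diagonal (fun a => e (B.lev a)) =
      (g : Matrix ι ι ℂ) * Matrix.diagonal (fun a => e (B.lev a)) * (↑g⁻¹ : Matrix ι ι ℂ) := by
  classical
  let m : Matrix ι ι ℂ := fun a b => if B.bl a = B.bl b ∧ B.lev b ≤ B.lev a then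
    ∏ k ∈ Finset.Ioc (B.lev b) (B.lev a), (e (B.lev b) - e k)⁻¹ else 0
  have hm1 : m - 1 ∈ Dg (fun a => - B.w a) (-1) := by
    intro a b hab
    rw [Matrix.sub_apply]
    by_cases h : a = b
    · subst h; simp [m]
    · rw [Matrix.one_apply_ne h, sub_zero]
      simp only [m]
      rw [if_neg]
      rintro ⟨h1, h2⟩
      apply h
      apply B.inj _ _ h1
      simp only [Blk.w, h1] at hab
      omega
  obtain ⟨m', hm', h1, h2⟩ := unip_inv hm1
  rw [add_sub_cancel] at h1 h2
  refine ⟨⟨m, 1 + m', h1, h2⟩, ?_⟩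
  change _ = m * _ * (1 + m')
  have key : (B.sh 1 + Matrix.diagonal (fun a => e (B.lev a))) * m
      = m * Matrix.diagonal (fun a => e (B.lev a)) := by
    ext a b
    rw [add_mul, Matrix.add_apply, Matrix.diagonal_mul, Matrix.mul_diagonal]
    by_cases hab : B.bl a = B.bl b
    · by_cases hl : B.lev b < B.lev a
      · obtain ⟨c, hc1, hc2⟩ := B.ex a (B.lev a - 1) (by have := B.lt a; omega)
        have hX : (B.sh 1 * m) a b = m c b := by
          rw [Matrix.mul_apply, Finset.sum_eq_single c]
          · simp only [Blk.sh]
            rw [if_pos ⟨hc1.symm, by omega⟩, one_mul]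
          · intro d _ hd
            simp only [Blk.sh]
            rw [if_neg, zero_mul]
            rintro ⟨h1, h2⟩
            exact hd (B.inj d c (by rw [hc1, h1]) (by omega))
          · simp
        rw [hX]
        simp only [m]
        rw [if_pos ⟨hc1.trans hab, by omega⟩, if_pos ⟨hab, hl.le⟩, hc2]
        obtain ⟨t, ht⟩ : ∃ t, B.lev a = t + 1 := ⟨B.lev a - 1, by omega⟩
        have hne : e (B.lev b) - e (t+1) ≠ 0 := by
          rw [← ht]; exact sub_ne_zero.mpr (he a _ hl)
        rw [ht, Nat.add_sub_cancel, ← Finset.insert_Ioc_right_eq_Ioc_add_one (by omega),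
          Finset.prod_insert (by simp)]
        field_simp
        ring
      · have hX : (B.sh 1 * m) a b = 0 := by
          rw [Matrix.mul_apply]
          apply Finset.sum_eq_zero
          intro d _
          simp only [Blk.sh, m]
          by_cases h1 : B.bl a = B.bl d ∧ B.lev a = B.lev d + 1
          · rw [if_neg (c := B.bl d = B.bl b ∧ _), mul_zero]
            rintro ⟨_, h3⟩; omega
          · rw [if_neg h1, zero_mul]
        rw [hX, zero_add]
        simp only [m]
        by_cases hl2 : B.lev b = B.lev a
        · rw [hl2]; ring
        · rw [if_neg (by rintro ⟨_, h⟩; omega)]; ring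
    · have hX : (B.sh 1 * m) a b = 0 := by
        rw [Matrix.mul_apply]
        apply Finset.sum_eq_zero
        intro d _
        simp only [Blk.sh, m]
        by_cases h1 : B.bl a = B.bl d ∧ B.lev a = B.lev d + 1
        · rw [if_neg (c := B.bl d = B.bl b ∧ _), mul_zero]
          rintro ⟨h2, h3⟩; exact hab (h1.1.trans h2)
        · rw [if_neg h1, zero_mul]
      rw [hX]
      simp only [m]
      rw [if_neg (fun h => hab h.1)]; ring
  rw [← key, mul_assoc, h1, mul_one]

theorem Blk.core (Y : Matrix ι ι ℂ) (T : Trip B.w (B.sh 1) Y) (e : ℕ → ℂ)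
    (he : ∀ a, ∀ i < B.lev a, e i ≠ e (B.lev a)) :
    ∃! M : Matrix ι ι ℂ, (∃ g : (Matrix ι ι ℂ)ˣ, M =
      (g : Matrix ι ι ℂ) * Matrix.diagonal (fun a => e (B.lev a)) * (↑g⁻¹ : Matrix ι ι ℂ)) ∧
      ∃ C, C * Y = Y * C ∧ M = B.sh 1 + C := by
  obtain ⟨A, hA, C, hC, h⟩ := T.exist (Matrix.diagonal (fun a => e (B.lev a))) (Dg_diag _)
  obtain ⟨A', hA', h1, h2⟩ := unip_inv hA
  refine ⟨B.sh 1 + C, ⟨?_, C, hC, rfl⟩, ?_⟩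
  · obtain ⟨g, hg⟩ := B.diagz e he
    let u : (Matrix ι ι ℂ)ˣ := ⟨1 + A, 1 + A', h1, h2⟩
    refine ⟨u * g, ?_⟩
    have : B.sh 1 + C = (1 + A) * (B.sh 1 + Matrix.diagonal (fun a => e (B.lev a))) * (1 + A') := by
      rw [h, mul_assoc, h1, mul_one]
    rw [this, hg, _root_.mul_inv_rev, Units.val_mul, Units.val_mul]
    change _ = ((1 + A) * _) * _ * (_ * (1 + A'))
    simp only [mul_assoc]
  · rintro M ⟨⟨g, hg⟩, C', hC', rfl⟩
    obtain ⟨A2, hA2, h3⟩ := B.conj e C' (T.cdeg C' hC') g hg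
    congr 1
    refine (T.uniq C C' (A2 + A' + A2 * A') hC hC' ?_ ?_).symm
    · exact Submodule.add_mem _ (Submodule.add_mem _ hA2 hA') (Dg_mul hA2 hA' (by omega))
    · have e1 : 1 + (A2 + A' + A2 * A') = (1 + A2) * (1 + A') := by noncomm_ring
      have e2 : (1 + A') * (B.sh 1 + C) =
          (B.sh 1 + Matrix.diagonal (fun a => e (B.lev a))) * (1 + A') := by
        calc (1 + A') * (B.sh 1 + C) = (1 + A') * ((B.sh 1 + C) * (1 + A)) * (1 + A') := by
              rw [mul_assoc, mul_assoc, h1, mul_one]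
          _ = _ := by rw [← h, ← mul_assoc, h2, one_mul]
      rw [e1, mul_assoc, e2, ← mul_assoc, h3, mul_assoc]

end blk
end SliceProof

namespace SliceProof
open Matrix

section struc
set_option linter.unusedSectionVars false
variable {E : Type*} [AddCommGroup E] [Module ℂ E] [FiniteDimensional ℂ E]

lemma noeig_gen (x y h : Module.End ℂ E) (hxy : x * y - y * x = h)
    (hhy : h * y - y * h = (-2 : ℂ) • y) (hhx : h * x - x * h = (2 : ℂ) • x)
    (μ c : ℂ) (hc : μ ≠ c) (u : E) (hu : u ∈ h.maxGenEigenspace μ)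
    (hh : h u = c • u) : u = 0 := by
  have h1 : u ∈ h.maxGenEigenspace c := by
    apply Module.End.mem_maxGenEigenspace _ _ _ |>.mpr
    refine ⟨1, ?_⟩
    simp [hh]
  have := Module.End.disjoint_genEigenspace h hc ⊤ ⊤
  exact Submodule.disjoint_def.mp this u hu h1

lemma gen_stable (x y h : Module.End ℂ E) (hxy : x * y - y * x = h)
    (hhy : h * y - y * h = (-2 : ℂ) • y) (hhx : h * x - x * h = (2 : ℂ) • x)
    (f : Module.End ℂ E) (hf : h * f = f * h) (μ : ℂ) (u : E)
    (hu : u ∈ h.maxGenEigenspace μ) : f u ∈ h.maxGenEigenspace μ :=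
  Module.End.mapsTo_maxGenEigenspace_of_comm (f := h) (g := f) hf μ hu

lemma y_gen (x y h : Module.End ℂ E) (hxy : x * y - y * x = h)
    (hhy : h * y - y * h = (-2 : ℂ) • y) (hhx : h * x - x * h = (2 : ℂ) • x)
    (μ : ℂ) (u : E) (hu : u ∈ h.maxGenEigenspace μ) :
    y u ∈ h.maxGenEigenspace (μ - 2) := by
  rw [Module.End.mem_maxGenEigenspace] at hu ⊢
  obtain ⟨k, hk⟩ := hu
  refine ⟨k, ?_⟩
  have h2 : h * y = y * h + (-2 : ℂ) • y := by rw [← hhy]; abel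
  have h3 : (h - (μ - 2) • 1) * y = y * (h - μ • 1) := by
    rw [sub_mul, h2, mul_sub, mul_smul_comm, smul_mul_assoc, mul_one, one_mul]
    module
  have h4 : ∀ k : ℕ, (h - (μ - 2) • 1) ^ k * y = y * (h - μ • 1) ^ k := by
    intro k
    induction k with
    | zero => simp
    | succ k ih => rw [pow_succ, mul_assoc, h3, ← mul_assoc, ih, mul_assoc, ← pow_succ]
  have := congrArg (fun f => f u) (h4 k)
  simp only [Module.End.mul_apply] at this
  rw [this, hk, map_zero]

lemma ker_sup_range (x y h : Module.End ℂ E) (hxy : x * y - y * x = h)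
    (hhy : h * y - y * h = (-2 : ℂ) • y) (hhx : h * x - x * h = (2 : ℂ) • x)
    : LinearMap.ker y ⊔ LinearMap.range x = ⊤ := by
  rw [eq_top_iff, ← Module.End.iSup_maxGenEigenspace_eq_top h]
  apply iSup_le
  intro μ v hv
  have hcy : h * (y * x) = y * x * h := comm_yx x y h hhy hhx
  have hcx : h * (x * y) = x * y * h := by
    have : x * y = h + y * x := by rw [← hxy]; abel
    rw [this, mul_add, add_mul, hcy]
  by_cases hμ : ∃ k : ℕ, μ = -(k:ℂ)
  · obtain ⟨k, rfl⟩ := hμ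
    obtain ⟨z, hz, hzv⟩ := sl2_surj x y h hxy hhy hhx (h.maxGenEigenspace (-(k:ℂ) - 2))
      (fun u hu => gen_stable x y h hxy hhy hhx h rfl _ u hu)
      (fun i u hu hh => noeig_gen x y h hxy hhy hhx _ _ (by
        intro hc
        have : ((-(k:ℤ) - 2 : ℤ) : ℂ) = ((i:ℤ) : ℂ) := by push_cast; exact hc
        have : (-(k:ℤ) - 2 : ℤ) = i := by exact_mod_cast this
        omega) u hu hh) (nilp h y (-2) (by norm_num) hhy)
      (fun u hu => gen_stable x y h hxy hhy hhx (y * x) hcy _ u hu) (y v)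
      (y_gen x y h hxy hhy hhx _ v hv)
    have : v = (v - x z) + x z := by abel
    rw [this]
    refine Submodule.add_mem_sup ?_ ⟨z, rfl⟩
    rw [LinearMap.mem_ker, map_sub, hzv, sub_self]
  · push Not at hμ
    obtain ⟨z, hz, hzv⟩ := sl2_surj_swap x y h hxy hhy hhx (h.maxGenEigenspace μ)
      (fun u hu => gen_stable x y h hxy hhy hhx h rfl _ u hu)
      (fun i u hu hh => noeig_gen x y h hxy hhy hhx _ _ (hμ i) u hu hh)
      (nilp h x 2 (by norm_num) hhx)
      (fun u hu => gen_stable x y h hxy hhy hhx (x * y) hcx _ u hu) v hv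
    exact Submodule.mem_sup_right ⟨y z, hzv⟩

lemma yx_pow (x y h : Module.End ℂ E) (hxy : x * y - y * x = h)
    (hhy : h * y - y * h = (-2 : ℂ) • y) (hhx : h * x - x * h = (2 : ℂ) • x)
    (l : E) (hl : y l = 0) (k : ℕ) :
    y ((x ^ (k+1)) l) = -((k:ℂ)+1) • (x ^ k) (h l + (k:ℂ) • l) := by
  obtain ⟨h1, h2, h3⟩ := swap_rel x y h hxy hhy hhx
  have := congrArg (fun f => f l) (comm_pow y x (-h) h1 h2 k)
  simp only [Module.End.mul_apply, LinearMap.sub_apply, LinearMap.smul_apply, LinearMap.neg_apply,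
            Module.End.one_apply, hl, map_zero, sub_zero] at this
  rw [this, neg_smul, ← smul_neg, ← map_neg (x ^ k), neg_add, sub_eq_add_neg]

lemma span_eig (x y h : Module.End ℂ E) (hxy : x * y - y * x = h)
    (hhy : h * y - y * h = (-2 : ℂ) • y) (hhx : h * x - x * h = (2 : ℂ) • x)
    (k : ℕ) : ∀ l : E, y l = 0 → (x ^ k) l = 0 →
    l ∈ Submodule.span ℂ {v : E | y v = 0 ∧ ∃ i < k, h v = -(i:ℂ) • v} := by
  induction k with
  | zero => intro l _ h0; simp at h0; subst h0; exact Submodule.zero_mem _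
  | succ k ih =>
    intro l hl hx
    have h2 : h * y = y * h + (-2 : ℂ) • y := by rw [← hhy]; abel
    have hyh : y (h l) = 0 := by
      have := congrArg (fun f => f l) h2
      simp [hl] at this
      exact this.symm
    have h1 := yx_pow x y h hxy hhy hhx l hl k
    rw [hx, map_zero] at h1
    have h3 : (x ^ k) (h l + (k:ℂ) • l) = 0 :=
      (smul_eq_zero.mp h1.symm).resolve_left (by
        rw [neg_eq_zero]; exact_mod_cast Nat.succ_ne_zero k)
    have h4 := ih (h l + (k:ℂ) • l) (by rw [map_add, hyh, map_smul, hl, smul_zero, add_zero]) h3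
    have h5 : ∀ v ∈ Submodule.span ℂ {v : E | y v = 0 ∧ ∃ i < k, h v = -(i:ℂ) • v},
        ∃ m ∈ Submodule.span ℂ {v : E | y v = 0 ∧ ∃ i < k, h v = -(i:ℂ) • v},
          y m = 0 ∧ h m + (k:ℂ) • m = v := by
      intro v hv
      induction hv using Submodule.span_induction with
      | mem v hv =>
        obtain ⟨hv1, i, hi, hv2⟩ := hv
        have hne : (k:ℂ) - i ≠ 0 := sub_ne_zero.mpr (by exact_mod_cast hi.ne')
        refine ⟨((k:ℂ) - i)⁻¹ • v, Submodule.smul_mem _ _ (Submodule.subset_span ⟨hv1, i, hi, hv2⟩),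
          by rw [map_smul, hv1, smul_zero], ?_⟩
        rw [map_smul, hv2, smul_smul, smul_smul, ← add_smul]
        convert one_smul ℂ v
        field_simp
        ring
      | zero => exact ⟨0, Submodule.zero_mem _, by simp, by simp⟩
      | add v v' _ _ ih1 ih2 =>
        obtain ⟨m, hm, hm1, hm2⟩ := ih1
        obtain ⟨m', hm', hm1', hm2'⟩ := ih2
        refine ⟨m + m', Submodule.add_mem _ hm hm', by rw [map_add, hm1, hm1', add_zero], ?_⟩
        rw [← hm2, ← hm2', map_add, smul_add]; abel
      | smul c v _ ih1 =>
        obtain ⟨m, hm, hm1, hm2⟩ := ih1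
        refine ⟨c • m, Submodule.smul_mem _ _ hm, by rw [map_smul, hm1, smul_zero], ?_⟩
        rw [← hm2, map_smul, smul_add, smul_comm]
    obtain ⟨m, hm, hm1, hm2⟩ := h5 _ h4
    have e : l = m + (l - m) := by abel
    rw [e]
    refine Submodule.add_mem _ (Submodule.span_mono ?_ hm) (Submodule.subset_span ⟨?_, k, by omega, ?_⟩)
    · rintro v ⟨hv, i, hi, hv2⟩
      exact ⟨hv, i, by omega, hv2⟩
    · rw [map_sub, hl, hm1, sub_self]
    · rw [map_sub, neg_smul, smul_sub, neg_sub, ← sub_eq_zero]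
      rw [← sub_eq_zero] at hm2
      rw [← neg_eq_zero, ← hm2]
      abel

lemma low_vec (x y h : Module.End ℂ E) (hxy : x * y - y * x = h)
    (hhy : h * y - y * h = (-2 : ℂ) • y) (hhx : h * x - x * h = (2 : ℂ) • x)
    (l : E) (hl : y l = 0) (h0 : l ≠ 0) (hm : ∃ μ : ℂ, h l = μ • l) :
    ∃ p : ℕ, (x ^ p) l = 0 ∧ h l = (1 - (p:ℂ)) • l ∧
      ∀ i < p, ∃ κ : ℂ, κ ≠ 0 ∧ (y ^ i) ((x ^ i) l) = κ • l := by
  classical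
  obtain ⟨μ, hμ⟩ := hm
  obtain ⟨N, hN⟩ := nilp h x 2 (by norm_num) hhx
  have hex : ∃ p, (x ^ p) l = 0 := ⟨N, by simp [hN]⟩
  have hp := Nat.find_spec hex
  have hmin := fun i => Nat.find_min hex (m := i)
  set p := Nat.find hex
  obtain ⟨d, hd⟩ : ∃ d, p = d + 1 := by
    refine ⟨p - 1, ?_⟩
    have : p ≠ 0 := by
      intro hp0; rw [hp0] at hp; exact h0 (by simpa using hp)
    omega
  have hyx : ∀ k : ℕ, y ((x ^ (k+1)) l) = (-((k:ℂ)+1) * (μ + k)) • (x ^ k) l := by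
    intro k
    rw [yx_pow x y h hxy hhy hhx l hl k, hμ, ← add_smul, map_smul, smul_smul]
  have hμd : μ = -(d:ℂ) := by
    have := hyx d
    rw [← hd, hp, map_zero] at this
    have := (smul_eq_zero.mp this.symm).resolve_right (hmin d (by omega))
    have := (mul_eq_zero.mp this).resolve_left (by
      rw [neg_eq_zero]; exact_mod_cast Nat.succ_ne_zero d)
    linear_combination this
  refine ⟨p, hp, ?_, ?_⟩
  · rw [hμ, hμd, hd]; push_cast; congr 1; ring
  · intro i
    induction i with
    | zero => intro _; exact ⟨1, one_ne_zero, by simp⟩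
    | succ i ih =>
      intro hi
      obtain ⟨κ, hκ, h1⟩ := ih (by omega)
      refine ⟨(-((i:ℂ)+1) * (μ + i)) * κ, ?_, ?_⟩
      · refine mul_ne_zero (mul_ne_zero ?_ ?_) hκ
        · rw [neg_ne_zero]; exact_mod_cast Nat.succ_ne_zero i
        · rw [hμd]
          intro hc
          have : ((i:ℕ):ℂ) = d := by linear_combination hc
          have : i = d := by exact_mod_cast this
          omega
      · rw [pow_succ y, Module.End.mul_apply, hyx, map_smul, h1, smul_smul]

lemma h_pow (x y h : Module.End ℂ E) (hxy : x * y - y * x = h)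
    (hhy : h * y - y * h = (-2 : ℂ) • y) (hhx : h * x - x * h = (2 : ℂ) • x)
    (l : E) (μ : ℂ) (hm : h l = μ • l) (i : ℕ) :
    h ((x ^ i) l) = (μ + 2 * i) • (x ^ i) l := by
  have h3 : h * x = x * h + (2 : ℂ) • x := by rw [← hhx]; abel
  induction i with
  | zero => simp [hm]
  | succ i ih =>
    have := congrArg (fun f => f ((x ^ i) l)) h3
    simp only [Module.End.mul_apply, LinearMap.add_apply, LinearMap.smul_apply, ih] at this
    rw [pow_succ', Module.End.mul_apply, this, map_smul]
    push_cast
    module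

/-- Decomposition into strings. -/
theorem exists_strings (x y h : Module.End ℂ E) (hxy : x * y - y * x = h)
    (hhy : h * y - y * h = (-2 : ℂ) • y) (hhx : h * x - x * h = (2 : ℂ) • x)
    : ∃ (b : Set E) (_ : Finite b) (p : b → ℕ)
    (bb : Module.Basis (Σ l : b, Fin (p l)) ℂ E),
    (∀ s, bb s = (x ^ (s.2 : ℕ)) (s.1 : E)) ∧ (∀ l : b, (x ^ (p l)) (l : E) = 0) ∧
    (∀ l : b, h (l : E) = (1 - (p l : ℂ)) • (l : E)) := by
  classical
  obtain ⟨N, hN⟩ := nilp h x 2 (by norm_num) hhx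
  set S : Set E := {v : E | y v = 0 ∧ ∃ i < N, h v = -(i:ℂ) • v} with hS
  obtain ⟨b, hbS, hbspan, hbli⟩ := exists_linearIndependent ℂ S
  have hfin : Finite b := hbli.finite
  have hlow : ∀ l : b, ∃ p : ℕ, (x ^ p) (l : E) = 0 ∧ h (l:E) = (1 - (p:ℂ)) • (l:E) ∧
      ∀ i < p, ∃ κ : ℂ, κ ≠ 0 ∧ (y ^ i) ((x ^ i) (l:E)) = κ • (l:E) := by
    intro l
    obtain ⟨h1, i, _, h2⟩ := hbS l.2
    exact low_vec x y h hxy hhy hhx l h1 (hbli.ne_zero l) ⟨_, h2⟩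
  choose p hp1 hp2 hp3 using hlow
  have := Fintype.ofFinite b
  let vec : (Σ l : b, Fin (p l)) → E := fun s => (x ^ (s.2 : ℕ)) (s.1 : E)
  have hli : LinearIndependent ℂ vec := by
    rw [Fintype.linearIndependent_iff]
    intro c hc
    by_contra hne
    push Not at hne
    obtain ⟨s0, hs0⟩ := hne
    obtain ⟨s, hs, hmax⟩ := Finset.exists_max_image
      (Finset.univ.filter fun s => c s ≠ 0) (fun s => (s.2 : ℕ)) ⟨s0, by simp [hs0]⟩
    simp only [Finset.mem_filter, Finset.mem_univ, true_and] at hs hmax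
    have hbli' : LinearIndepOn ℂ id b := hbli
    let ext := Module.Basis.extend hbli'
    let f : E →ₗ[ℂ] ℂ := ext.coord ⟨s.1, LinearIndepOn.subset_extend hbli' (Set.subset_univ b) s.1.2⟩
    have hf : ∀ l : b, f l = if l = s.1 then 1 else 0 := by
      intro l
      have : (l : E) = ext ⟨l, LinearIndepOn.subset_extend hbli' (Set.subset_univ b) l.2⟩ := by
        rw [Module.Basis.extend_apply_self]
      rw [this]
      simp only [f, Module.Basis.coord_apply, Module.Basis.repr_self, Finsupp.single_apply,
        Subtype.ext_iff]
    have h1 : f ((y ^ (s.2:ℕ)) (∑ t, c t • vec t)) = 0 := by rw [hc, map_zero, map_zero]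
    rw [map_sum, map_sum, Finset.sum_eq_single s] at h1
    · obtain ⟨κ, hκ, h2⟩ := hp3 s.1 s.2 s.2.2
      simp only [vec, map_smul, h2, hf, if_true, smul_eq_mul, mul_one] at h1
      exact (mul_ne_zero hs hκ) h1
    · intro t _ hts
      by_cases hct : c t = 0
      · rw [hct, zero_smul, map_zero, map_zero]
      · have hle := hmax t hct
        obtain ⟨κ, hκ, h2⟩ := hp3 t.1 t.2 t.2.2
        rcases hle.lt_or_eq with hlt | heq
        · have : (y ^ (s.2:ℕ)) (vec t) = 0 := by
            obtain ⟨m, hm⟩ : ∃ m, (s.2:ℕ) = m + 1 + t.2 := ⟨s.2 - t.2 - 1, by omega⟩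
            rw [hm, pow_add, Module.End.mul_apply, h2, map_smul, pow_succ, Module.End.mul_apply,
              (hbS t.1.2).1, map_zero, smul_zero]
          rw [map_smul, this, smul_zero, map_zero]
        · rw [map_smul, ← heq, h2, map_smul, map_smul, hf, if_neg, smul_zero, smul_zero]
          intro h3
          apply hts
          obtain ⟨t1, t2⟩ := t
          obtain ⟨s1, s2⟩ := s
          simp only at h3
          subst h3
          congr 1
          exact Fin.ext heq
    · simp
  have hspan : ⊤ ≤ Submodule.span ℂ (Set.range vec) := by
    set W := Submodule.span ℂ (Set.range vec) with hW
    have hall : ∀ (l : b) (i : ℕ), (x ^ i) (l : E) ∈ W := by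
      intro l i
      by_cases hi : i < p l
      · exact Submodule.subset_span ⟨⟨l, ⟨i, hi⟩⟩, rfl⟩
      · obtain ⟨m, hm⟩ : ∃ m, i = m + p l := ⟨i - p l, by omega⟩
        rw [hm, pow_add, Module.End.mul_apply, hp1, map_zero]
        exact Submodule.zero_mem _
    have hker : LinearMap.ker y ≤ W := by
      intro l hl
      have := span_eig x y h hxy hhy hhx N l hl (by simp [hN])
      rw [← hS, ← hbspan] at this
      refine Submodule.span_le.mpr ?_ this
      intro v hv
      simpa using hall ⟨v, hv⟩ 0
    have hxW : ∀ v ∈ W, x v ∈ W := by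
      intro v hv
      have : W ≤ W.comap x := by
        rw [hW, Submodule.span_le]
        rintro _ ⟨s, rfl⟩
        change x ((x ^ (s.2:ℕ)) (s.1:E)) ∈ W
        rw [← Module.End.mul_apply, ← pow_succ']
        exact hall _ _
      exact this hv
    have key : ∀ k : ℕ, ∀ v : E, ∃ u ∈ W, ∃ z, v = u + (x ^ k) z := by
      intro k
      induction k with
      | zero => intro v; exact ⟨0, Submodule.zero_mem _, v, by simp⟩
      | succ k ih =>
        intro v
        have hv : v ∈ LinearMap.ker y ⊔ LinearMap.range x := by
          rw [ker_sup_range x y h hxy hhy hhx]; trivial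
        obtain ⟨l, hl, _, ⟨z, rfl⟩, rfl⟩ := Submodule.mem_sup.mp hv
        obtain ⟨u, hu, z', rfl⟩ := ih z
        refine ⟨l + x u, Submodule.add_mem _ (hker hl) (hxW u hu), z', ?_⟩
        rw [map_add, pow_succ', Module.End.mul_apply, add_assoc]
    intro v _
    obtain ⟨u, hu, z, rfl⟩ := key N v
    rw [hN]
    simpa using hu
  refine ⟨b, hfin, p, Module.Basis.mk hli hspan, ?_, hp1, hp2⟩
  intro s
  rw [Module.Basis.mk_apply]

end struc

theorem exists_blk {n : ℕ} (X H Y : Matrix (Fin n) (Fin n) ℂ)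
    (hHX : H * X - X * H = (2 : ℂ) • X)
    (hHY : H * Y - Y * H = (-2 : ℂ) • Y)
    (hXY : X * Y - Y * X = H) :
    ∃ (J : Type) (B : Blk (Fin n) J) (Q : (Matrix (Fin n) (Fin n) ℂ)ˣ),
      X * (Q : Matrix (Fin n) (Fin n) ℂ) = Q * B.sh 1 ∧
      H * (Q : Matrix (Fin n) (Fin n) ℂ) = Q * Matrix.diagonal (fun a => (B.w a : ℂ)) := by
  classical
  let τ := Matrix.toLinAlgEquiv' (R := ℂ) (n := Fin n)
  have r1 : τ X * τ Y - τ Y * τ X = τ H := by rw [← map_mul, ← map_mul, ← map_sub, hXY]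
  have r2 : τ H * τ Y - τ Y * τ H = (-2 : ℂ) • τ Y := by
    rw [← map_mul, ← map_mul, ← map_sub, hHY, map_smul]
  have r3 : τ H * τ X - τ X * τ H = (2 : ℂ) • τ X := by
    rw [← map_mul, ← map_mul, ← map_sub, hHX, map_smul]
  obtain ⟨b, hfin, p, bb, hb1, hb2, hb3⟩ := exists_strings (τ X) (τ Y) (τ H) r1 r2 r3
  have := Fintype.ofFinite b
  let φ : (Σ l : b, Fin (p l)) ≃ Fin n := bb.indexEquiv (Pi.basisFun ℂ (Fin n))
  let B : Blk (Fin n) b :=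
    { bl := fun a => (φ.symm a).1
      lev := fun a => (φ.symm a).2
      len := p
      inj := by
        intro a c h1 h2
        apply φ.symm.injective
        generalize φ.symm a = s at *
        generalize φ.symm c = t at *
        obtain ⟨t1, t2⟩ := t
        obtain ⟨s1, s2⟩ := s
        simp only at h1 h2
        subst h1
        congr 1
        exact Fin.ext h2
      lt := fun a => (φ.symm a).2.2
      ex := fun a i hi => ⟨φ ⟨(φ.symm a).1, ⟨i, hi⟩⟩, by rw [Equiv.symm_apply_apply], by rw [Equiv.symm_apply_apply]⟩ }
  let b' := bb.reindex φ
  let Q0 := (Pi.basisFun ℂ (Fin n)).toMatrix b'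
  let _ : Invertible Q0 := (Pi.basisFun ℂ (Fin n)).invertibleToMatrix b'
  have hb' : ∀ c, b' c = ((τ X) ^ (B.lev c)) ((B.bl c : Fin n → ℂ)) := by
    intro c
    simp only [b', Module.Basis.reindex_apply, hb1]
    rfl
  have hQ0 : ∀ a c, Q0 a c = b' c a := by
    intro a c
    simp [Q0, Module.Basis.toMatrix_apply]
  have hmul : ∀ (A : Matrix (Fin n) (Fin n) ℂ) a c, (A * Q0) a c = (τ A) (b' c) a := by
    intro A a c
    simp only [Matrix.mul_apply, hQ0, τ, Matrix.toLinAlgEquiv'_apply, Matrix.mulVec, dotProduct]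
  refine ⟨b, B, unitOfInvertible Q0, ?_, ?_⟩
  · change X * Q0 = Q0 * B.sh 1
    ext a c
    rw [hmul, hb', ← Module.End.mul_apply, ← pow_succ', Matrix.mul_apply]
    by_cases h : B.lev c + 1 < B.len (B.bl c)
    · obtain ⟨d, hd1, hd2⟩ := B.ex c _ h
      rw [Finset.sum_eq_single d]
      · simp only [Blk.sh]
        rw [if_pos ⟨hd1, hd2⟩, mul_one, hQ0, hb', hd1, hd2]
      · intro t _ ht
        simp only [Blk.sh]
        rw [if_neg, mul_zero]
        rintro ⟨h1, h2⟩
        exact ht (B.inj t d (h1.trans hd1.symm) (by omega))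
      · simp
    · have hlen : B.lev c + 1 = p (B.bl c) := by
        have := B.lt c
        change B.lev c < p (B.bl c) at this
        change ¬ (B.lev c + 1 < p (B.bl c)) at h
        omega
      rw [hlen, hb2]
      symm
      apply Finset.sum_eq_zero
      intro d _
      simp only [Blk.sh]
      rw [if_neg, mul_zero]
      rintro ⟨h1, h2⟩
      have := B.lt d
      rw [h1] at this; omega
  · change H * Q0 = Q0 * _
    ext a c
    rw [hmul, Matrix.mul_diagonal, hQ0, hb',
      h_pow (τ X) (τ Y) (τ H) r1 r2 r3 _ _ (hb3 (B.bl c)) (B.lev c), Pi.smul_apply, smul_eq_mul,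
      mul_comm]
    congr 1
    simp only [Blk.w]
    push_cast
    change 1 - (p (B.bl c) : ℂ) + _ = _ - (p (B.bl c) : ℂ)
    ring

end SliceProof

namespace SliceProof
open Matrix

lemma conj_mul {R : Type*} [Ring R] (Q : Rˣ) (a b : R) :
    ((Q : R) * a * ↑Q⁻¹) * ((Q : R) * b * ↑Q⁻¹) = (Q : R) * (a * b) * ↑Q⁻¹ := by
  simp [mul_assoc]

lemma conj_inj {R : Type*} [Ring R] (Q : Rˣ) {a b : R}
    (h : (Q : R) * a * ↑Q⁻¹ = (Q : R) * b * ↑Q⁻¹) : a = b := by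
  simpa using h

lemma transport {R : Type*} [Ring R] (Q : Rˣ) (X S Y Y' ν D : R)
    (hX : X = ↑Q * S * ↑Q⁻¹) (hY : Y = ↑Q * Y' * ↑Q⁻¹)
    (hν : ∃ p : Rˣ, ν = ↑p * D * ↑p⁻¹)
    (h : ∃! M : R, (∃ g : Rˣ, M = ↑g * D * ↑g⁻¹) ∧ ∃ C, C * Y' = Y' * C ∧ M = S + C) :
    ∃! M : R, (∃ g : Rˣ, M = ↑g * ν * ↑g⁻¹) ∧ ∃ C, C * Y = Y * C ∧ M = X + C := by
  obtain ⟨p, hp⟩ := hν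
  obtain ⟨M, ⟨⟨g, hg⟩, C, hC, hM⟩, hu⟩ := h
  refine ⟨↑Q * M * ↑Q⁻¹, ⟨⟨Q * g * p⁻¹, ?_⟩, ↑Q * C * ↑Q⁻¹, ?_, ?_⟩, ?_⟩
  · rw [hg, hp]; simp [mul_assoc]
  · rw [hY, conj_mul, conj_mul, hC]
  · rw [hM, hX, mul_add, add_mul]
  · rintro N ⟨⟨g', hg'⟩, C', hC', hN⟩
    have h1 := hu (↑Q⁻¹ * N * ↑Q) ⟨⟨Q⁻¹ * g' * p, ?_⟩, ↑Q⁻¹ * C' * ↑Q, ?_, ?_⟩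
    · rw [← h1]; simp [mul_assoc]
    · rw [hg', hp]; simp [mul_assoc]
    · apply conj_inj Q
      have h3 : (Q : R) * (↑Q⁻¹ * C' * ↑Q) * ↑Q⁻¹ = C' := by simp [mul_assoc]
      rw [← conj_mul Q _ Y', ← conj_mul Q Y', ← hY, h3, hC']
    · rw [hN, hX]; simp [mul_add, add_mul, mul_assoc]

lemma perm_conj {n : ℕ} (d : Fin n → ℂ) (φ : Fin n ≃ Fin n) :
    ∃ p : (Matrix (Fin n) (Fin n) ℂ)ˣ,
      diagonal d = p.val * diagonal (fun a => d (φ a)) * (p⁻¹).val := by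
  have h1 : (φ.symm.toPEquiv.toMatrix : Matrix (Fin n) (Fin n) ℂ) * φ.toPEquiv.toMatrix = 1 := by
    rw [← PEquiv.toMatrix_trans, ← Equiv.toPEquiv_trans]; simp
  have h2 : (φ.toPEquiv.toMatrix : Matrix (Fin n) (Fin n) ℂ) * φ.symm.toPEquiv.toMatrix = 1 := by
    rw [← PEquiv.toMatrix_trans, ← Equiv.toPEquiv_trans]; simp
  refine ⟨⟨φ.symm.toPEquiv.toMatrix, φ.toPEquiv.toMatrix, h1, h2⟩, ?_⟩
  simp only [Units.inv_mk]
  rw [PEquiv.toMatrix_toPEquiv_mul, PEquiv.mul_toMatrix_toPEquiv]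
  ext i j
  by_cases h : i = j
  · subst h; simp
  · simp [h]

lemma card_lev {n : ℕ} {J : Type} (B : Blk (Fin n) J) (X : Matrix (Fin n) (Fin n) ℂ)
    (Q : (Matrix (Fin n) (Fin n) ℂ)ˣ) (hX : X = Q.val * B.sh 1 * (Q⁻¹).val) (k : ℕ) :
    Module.finrank ℂ (LinearMap.ker (Matrix.mulVecLin (X ^ k)))
      = (Finset.univ.filter fun a => B.lev a < k).card := by
  have h1 : X ^ k = Q.val * B.sh k * (Q⁻¹).val := by
    rw [hX, Units.conj_pow, B.sh_pow]
  have h2 : (X ^ k).rank = (B.sh k).rank := by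
    rw [h1]
    rw [Matrix.rank_mul_eq_left_of_isUnit_det, Matrix.rank_mul_eq_right_of_isUnit_det]
    · exact (Matrix.isUnit_iff_isUnit_det _).1 Q.isUnit
    · exact (Matrix.isUnit_iff_isUnit_det _).1 (Q⁻¹).isUnit
  have h3 := LinearMap.finrank_range_add_finrank_ker (Matrix.mulVecLin (X ^ k))
  have h4 : (X ^ k).rank = Module.finrank ℂ (LinearMap.range (Matrix.mulVecLin (X ^ k))) := rfl
  rw [← h4, h2, B.rank_sh] at h3
  have h5 := Finset.card_filter_add_card_filter_not (s := (Finset.univ : Finset (Fin n)))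
    (fun a => k ≤ B.lev a)
  simp only [not_le] at h5
  simp only [Module.finrank_fintype_fun_eq_card, Finset.card_univ, Fintype.card_fin] at h3 h5
  omega

lemma main {n r : ℕ}
    (q : Fin r → ℕ) (hq : ∀ i, 0 < q i) (hsum : ∑ i, q i = n)
    (X H Y : Matrix (Fin n) (Fin n) ℂ)
    (e : Fin r → ℂ) (c : Fin n → Fin r) (hinj : Function.Injective e)
    (hc : ∀ i, (Finset.univ.filter fun j => c j = i).card = q i)
    (hHX : H * X - X * H = (2 : ℂ) • X)
    (hHY : H * Y - Y * H = (-2 : ℂ) • Y)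
    (hXY : X * Y - Y * X = H)
    (σ : Equiv.Perm (Fin r))
    (hker : ∀ k : ℕ, k ≤ n →
        Module.finrank ℂ (LinearMap.ker (Matrix.mulVecLin (X ^ k)))
          = ∑ i ∈ Finset.univ.filter (fun i : Fin r => (i : ℕ) < k), q (σ i))
    (ν : Matrix (Fin n) (Fin n) ℂ)
    (hν : ∃ g : (Matrix (Fin n) (Fin n) ℂ)ˣ,
      ν = g.val * diagonal (fun j => e (c j)) * (g⁻¹).val) :
    ∃! M : Matrix (Fin n) (Fin n) ℂ,
      (∃ g : (Matrix (Fin n) (Fin n) ℂ)ˣ, M = g.val * ν * (g⁻¹).val) ∧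
        ∃ C, C * Y = Y * C ∧ M = X + C := by
  obtain ⟨J, B, Q, hQX, hQH⟩ := exists_blk X H Y hHX hHY hXY
  have hX : X = Q.val * B.sh 1 * (Q⁻¹).val := by rw [← hQX]; simp [mul_assoc]
  have hH : H = Q.val * diagonal (fun a => (B.w a : ℂ)) * (Q⁻¹).val := by
    rw [← hQH]; simp [mul_assoc]
  obtain ⟨Y', hY⟩ : ∃ Y', Y = Q.val * Y' * (Q⁻¹).val := ⟨(Q⁻¹).val * Y * Q.val, by simp [mul_assoc]⟩
  have T : Trip B.w (B.sh 1) Y' := by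
    refine ⟨?_, ?_, ?_⟩
    · rw [ad_apply]
      apply conj_inj Q
      rw [mul_sub, sub_mul, ← conj_mul, ← conj_mul, ← hX, ← hH, hHX, hX]
      simp
    · rw [ad_apply]
      apply conj_inj Q
      rw [mul_sub, sub_mul, ← conj_mul, ← conj_mul, ← hY, ← hH, hHY, hY]
      simp
    · apply conj_inj Q
      rw [mul_sub, sub_mul, ← conj_mul, ← conj_mul, ← hX, ← hY, ← hH, hXY]
  have hcount : ∀ k ≤ n, (Finset.univ.filter fun a => B.lev a < k).card
      = ∑ i ∈ Finset.univ.filter (fun i : Fin r => (i : ℕ) < k), q (σ i) := by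
    intro k hk
    rw [← hker k hk, card_lev B X Q hX]
  have hrn : r ≤ n := by
    rw [← hsum]
    calc r = ∑ i : Fin r, 1 := by simp
      _ ≤ _ := Finset.sum_le_sum fun i _ => hq i
  have hlev : ∀ a, B.lev a < r := by
    have h1 := hcount r hrn
    rw [Finset.filter_true_of_mem (s := (Finset.univ : Finset (Fin r))) (fun i _ => i.2),
      Equiv.sum_comp σ q, hsum] at h1
    have h2 : (Finset.univ.filter fun a => B.lev a < r) = Finset.univ := by
      apply Finset.eq_univ_of_card; simp [h1]
    intro a
    have := Finset.mem_univ a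
    rw [← h2] at this
    simpa using this
  have hfib : ∀ k : Fin r, (Finset.univ.filter fun a => B.lev a = k).card = q (σ k) := by
    intro k
    have h1 := hcount k (by omega)
    have h2 := hcount (k + 1) (by omega)
    have h3 : (Finset.univ.filter fun a => B.lev a < (k:ℕ) + 1) =
        (Finset.univ.filter fun a => B.lev a < k) ∪ Finset.univ.filter fun a => B.lev a = k := by
      ext a; simp; omega
    have h4 : (Finset.univ.filter fun i : Fin r => (i:ℕ) < (k:ℕ) + 1) =
        insert k (Finset.univ.filter fun i : Fin r => (i:ℕ) < k) := by
      ext a; simp [Fin.ext_iff]; omega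
    rw [h3, Finset.card_union_of_disjoint, h4, Finset.sum_insert (by simp), h1] at h2
    · omega
    · rw [Finset.disjoint_filter]; intro a _ h; omega
  let f : Fin n → Fin r := fun a => σ ⟨B.lev a, hlev a⟩
  have hf : ∀ i, (Finset.univ.filter fun j => f j = i).card = q i := by
    intro i
    have := hfib (σ.symm i)
    rw [Equiv.apply_symm_apply] at this
    rw [← this]
    congr 1
    ext a
    simp [f, ← Equiv.eq_symm_apply, Fin.ext_iff]
  have hequiv : ∀ i, Nonempty ({a // f a = i} ≃ {a // c a = i}) := fun i => by
    rw [← Fintype.card_eq, Fintype.card_subtype, Fintype.card_subtype, hf, hc]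
  let φ : Fin n ≃ Fin n := Equiv.ofFiberEquiv (f := f) (g := c) fun i => (hequiv i).some
  have hφ : ∀ a, c (φ a) = f a := fun a => Equiv.ofFiberEquiv_map _ a
  let e' : ℕ → ℂ := fun i => if h : i < r then e (σ ⟨i, h⟩) else 0
  have he' : ∀ a, e' (B.lev a) = e (f a) := fun a => by simp [e', f, hlev a]
  have hne : ∀ a, ∀ i < B.lev a, e' i ≠ e' (B.lev a) := by
    intro a i hi h
    have h1 := hlev a
    simp only [e', dif_pos h1, dif_pos (hi.trans h1)] at h
    have := σ.injective (hinj h)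
    simp at this
    omega
  refine transport Q X (B.sh 1) Y Y' ν _ hX hY ?_ (B.core Y' T e' hne)
  obtain ⟨g, hg⟩ := hν
  obtain ⟨p, hp⟩ := perm_conj (fun j => e (c j)) φ
  refine ⟨g * p, ?_⟩
  simp only [hφ] at hp
  rw [hg, hp]
  simp only [he']
  simp [mul_assoc]

end SliceProof


/-- Counting form (via Rao's lemma) of the `GL(n,ℂ)` limit formula
`lim_{t→0⁺} O_{tξ} = O_𝓛` (Barbasch’s limit formula, Proposition 4.6): if `ν` is diagonalizable over `ℂ` with
exactly `r` distinct eigenvalues of multiplicities `q_1,…,q_r`, and `(X,H,Y)` is an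
`sl₂`-triple with `dim ker X^k` equal to the sum of the `k` largest values among the
`q_i`, then `O_ν ∩ (X + Z(Y))` has exactly one element. -/
theorem orbit_inter_slice_unique_gl_complex
    {n r : ℕ} (hn : 1 ≤ n)
    (q : Fin r → ℕ) (hq : ∀ i, 0 < q i) (hsum : ∑ i, q i = n)
    (ν X H Y : Matrix (Fin n) (Fin n) ℂ)
    -- `ν` is diagonalizable over `ℂ` with exactly `r` distinct eigenvalues of
    -- multiplicities `q_1, …, q_r`:
    (hν : ∃ (g : GL (Fin n) ℂ) (e : Fin r → ℂ) (c : Fin n → Fin r),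
        Function.Injective e ∧
        (∀ i, (Finset.univ.filter fun j => c j = i).card = q i) ∧
        ν = (g : Matrix (Fin n) (Fin n) ℂ) * Matrix.diagonal (fun j => e (c j)) *
              (↑g⁻¹ : Matrix (Fin n) (Fin n) ℂ))
    -- `(X, H, Y)` is an `sl₂`-triple:
    (hX0 : X ≠ 0)
    (hHX : H * X - X * H = (2 : ℂ) • X)
    (hHY : H * Y - Y * H = (-2 : ℂ) • Y)
    (hXY : X * Y - Y * X = H)
    -- `dim ker X^k` is the sum of the `k` largest values among `q_1, …, q_r`
    -- (expressed via a rearrangement `σ` of the `q_i` into decreasing order):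
    (σ : Equiv.Perm (Fin r)) (hσ : Antitone fun i => q (σ i))
    (hker : ∀ k : ℕ, k ≤ n →
        Module.finrank ℂ (LinearMap.ker (Matrix.mulVecLin (X ^ k)))
          = ∑ i ∈ Finset.univ.filter (fun i : Fin r => (i : ℕ) < k), q (σ i)) :
    ∃! M : Matrix (Fin n) (Fin n) ℂ,
      M ∈ ({M | ∃ g : GL (Fin n) ℂ,
              M = (g : Matrix (Fin n) (Fin n) ℂ) * ν * (↑g⁻¹ : Matrix (Fin n) (Fin n) ℂ)} ∩
            {M | ∃ C, C * Y = Y * C ∧ M = X + C} : Set (Matrix (Fin n) (Fin n) ℂ)) := by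
  obtain ⟨g, e, c, hinj, hc, hg⟩ := hν
  exact SliceProof.main q hq hsum X H Y e c hinj hc hHX hHY hXY σ hker ν ⟨g, hg⟩
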